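/- arXiv:math/0012135 — 2 statements merged into one kernel-verified Lean document; each statement's English description precedes it below -/
import Mathlib

section
/- Let k be a field of characteristic p > 0 and let C^{-1} : Ω^q_k → Ω^q_k/dΩ^{q-1}_k denote the inverse Cartier operator determined by x · dy_1/y_1 ∧ … ∧ dy_q/y_q ↦ x^p · dy_1/y_1 ∧ … ∧ dy_q/y_q. Then C^{-1} is a well-defined additive map which is p-semilinear: C^{-1}(a x ω) = a^p C^{-1}(x ω) for scalars a ∈ k, in the sense that C^{-1}(aω) = a^p C^{-1}(ω) for ω a product of logarithmic differentials. -/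
open ExteriorAlgebra

/-- The element `x·dm₁ ∧ … ∧ dm_q` of the `q`-th exterior power `Ω^q_k` of the module of
Kähler differentials of `k` (over the prime ring). -/
noncomputable def dform (k : Type*) [Field k] (q : ℕ) (x : k) (m : Fin q → k) :
    ↥(⋀[k]^q (Ω[k⁄ℤ])) :=
  x • ⟨ιMulti k q (fun i => KaehlerDifferential.D ℤ k (m i)),
    ιMulti_range k q (Set.mem_range_self _)⟩

/-- The logarithmic form `x·dy₁/y₁ ∧ … ∧ dy_q/y_q` in `Ω^q_k`. -/
noncomputable def lform (k : Type*) [Field k] (q : ℕ) (x : k) (y : Fin q → kˣ) :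
    ↥(⋀[k]^q (Ω[k⁄ℤ])) :=
  x • ⟨ιMulti k q (fun i => ((y i : k)⁻¹ : k) • KaehlerDifferential.D ℤ k (y i)),
    ιMulti_range k q (Set.mem_range_self _)⟩

/-- The de Rham differentials `d : Ω^q_k → Ω^{q+1}_k` on the exterior powers of the
module of Kähler differentials, determined by `d(x·dm₁∧…∧dm_q) = dx∧dm₁∧…∧dm_q`,
with `d ∘ d = 0`. -/
structure ExtD (k : Type*) [Field k] where
  d : ∀ q : ℕ, ↥(⋀[k]^q (Ω[k⁄ℤ])) →+ ↥(⋀[k]^(q + 1) (Ω[k⁄ℤ]))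
  d_apply : ∀ (q : ℕ) (x : k) (m : Fin q → k),
    d q (dform k q x m) = dform k (q + 1) 1 (Fin.cons x m)
  d_d : ∀ (q : ℕ) (ω : ↥(⋀[k]^q (Ω[k⁄ℤ]))), d (q + 1) (d q ω) = 0

/-- The wedge product `Ω^i_k × Ω^j_k → Ω^{i+j}_k`. -/
noncomputable def wedge (k : Type*) [Field k] {i j : ℕ}
    (ω : ↥(⋀[k]^i (Ω[k⁄ℤ]))) (η : ↥(⋀[k]^j (Ω[k⁄ℤ]))) :
    ↥(⋀[k]^(i + j) (Ω[k⁄ℤ])) :=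
  ⟨(ω : ExteriorAlgebra k (Ω[k⁄ℤ])) * (η : ExteriorAlgebra k (Ω[k⁄ℤ])), by
    rw [exteriorPower, pow_add]
    exact Submodule.mul_mem_mul ω.2 η.2⟩

open KaehlerDifferential

section Additivity

/-- The defect of additivity of `x ↦ x^(p-1) dx` is exact in the free module of differentials of
a polynomial ring over `ℤ`. -/
theorem MvPolynomial.exists_pow_smul_D_add {σ : Type*} {p : ℕ} (hp : p.Prime)
    (x y : MvPolynomial σ ℤ) :
    ∃ b, (x + y) ^ (p - 1) • D ℤ (MvPolynomial σ ℤ) (x + y) =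
      x ^ (p - 1) • D ℤ (MvPolynomial σ ℤ) x + y ^ (p - 1) • D ℤ (MvPolynomial σ ℤ) y +
        D ℤ (MvPolynomial σ ℤ) b := by
  obtain ⟨r, hr⟩ := exists_add_pow_prime_eq hp x y
  refine ⟨x * y * r, ?_⟩
  have hb : Module.Free (MvPolynomial σ ℤ) Ω[MvPolynomial σ ℤ⁄ℤ] :=
    Module.Free.of_basis (mvPolynomialBasis ℤ σ)
  have hr' : (x + y) ^ p = x ^ p + y ^ p + (p : ℕ) • (x * y * r) := by
    rw [hr, nsmul_eq_mul]; ring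
  have key := congrArg (D ℤ (MvPolynomial σ ℤ)) hr'
  simp only [map_add, Derivation.leibniz_pow, map_nsmul, ← smul_add] at key
  have hp0 : (p : MvPolynomial σ ℤ) ≠ 0 := by exact_mod_cast hp.ne_zero
  simp only [← Nat.cast_smul_eq_nsmul (MvPolynomial σ ℤ)] at key
  rw [map_add]
  exact smul_right_injective _ hp0 key

/-- The map `x ↦ x^(p-1) dx` is additive modulo exact differentials. -/
theorem KaehlerDifferential.exists_pow_smul_D_add {A : Type*} [CommRing A] {p : ℕ} (hp : p.Prime)
    (x y : A) :
    ∃ b, (x + y) ^ (p - 1) • D ℤ A (x + y) =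
      x ^ (p - 1) • D ℤ A x + y ^ (p - 1) • D ℤ A y + D ℤ A b := by
  let R := MvPolynomial (Fin 2) ℤ
  let _ : Algebra R A := (MvPolynomial.aeval (R := ℤ) ![x, y]).toRingHom.toAlgebra
  obtain ⟨b, hb⟩ := MvPolynomial.exists_pow_smul_D_add hp
    (MvPolynomial.X 0 : R) (MvPolynomial.X 1)
  have hx : algebraMap R A (MvPolynomial.X 0) = x :=
    (MvPolynomial.aeval_X (R := ℤ) ![x, y] 0)
  have hy : algebraMap R A (MvPolynomial.X 1) = y :=
    (MvPolynomial.aeval_X (R := ℤ) ![x, y] 1)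
  refine ⟨algebraMap R A b, ?_⟩
  have key := congrArg (KaehlerDifferential.map ℤ ℤ R A) hb
  have hm (z w : R) : KaehlerDifferential.map ℤ ℤ R A (z • D ℤ R w) =
      algebraMap R A z • D ℤ A (algebraMap R A w) := by
    rw [LinearMap.map_smul, map_D, algebraMap_smul]
  rw [LinearMap.map_add, LinearMap.map_add, hm, hm, hm, map_D] at key
  simpa only [map_pow, RingHom.map_add, hx, hy] using key

end Additivity

section FrobeniusTwist

/-- The module `M` with scalars restricted along the ring endomorphism `φ`. -/
def ScalarTwist {k : Type*} [CommRing k] (_φ : k →+* k) (M : Type*) : Type _ := M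

namespace ScalarTwist

variable {k : Type*} [CommRing k] (φ : k →+* k) {M : Type*} [AddCommGroup M] [Module k M]

instance : AddCommGroup (ScalarTwist φ M) := inferInstanceAs (AddCommGroup M)

instance : Module k (ScalarTwist φ M) := Module.compHom M φ

/-- The identity map, from `M` to its twist. -/
def of : M ≃+ ScalarTwist φ M := AddEquiv.refl M

theorem smul_of (a : k) (m : M) : a • of φ m = of φ (φ a • m) := rfl

theorem of_symm_smul (a : k) (m : ScalarTwist φ M) :
    (of φ).symm (a • m) = φ a • (of φ).symm m := rfl

/-- A linear map into a twist of `M` induces a linear map of exterior powers. -/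
noncomputable def exteriorPowerMap {N : Type*} [AddCommGroup N] [Module k N] (n : ℕ)
    (c : N →ₗ[k] ScalarTwist φ M) : ⋀[k]^n N →ₗ[k] ScalarTwist φ (⋀[k]^n M) :=
  exteriorPower.alternatingMapLinearEquiv
    { toFun v := of φ (exteriorPower.ιMulti k n fun i => (of φ).symm (c (v i)))
      map_update_add' {_} v i x y := by
        have h (z : N) : (fun j => (of φ).symm (c (Function.update v i z j))) =
            Function.update (fun j => (of φ).symm (c (v j))) i ((of φ).symm (c z)) := by
          ext j; by_cases hj : j = i
          · subst hj; simp
          · simp [hj]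
        simp only [h, map_add, AlternatingMap.map_update_add]
      map_update_smul' {_} v i a x := by
        have h (z : N) : (fun j => (of φ).symm (c (Function.update v i z j))) =
            Function.update (fun j => (of φ).symm (c (v j))) i ((of φ).symm (c z)) := by
          ext j; by_cases hj : j = i
          · subst hj; simp
          · simp [hj]
        simp only [h, map_smul, of_symm_smul, AlternatingMap.map_update_smul, smul_of]
      map_eq_zero_of_eq' v i j hv hij := by
        rw [AlternatingMap.map_eq_zero_of_eq _ _ (by simp only [hv]) hij, map_zero] }

theorem exteriorPowerMap_ιMulti {N : Type*} [AddCommGroup N] [Module k N] (n : ℕ)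
    (c : N →ₗ[k] ScalarTwist φ M) (v : Fin n → N) :
    exteriorPowerMap φ n c (exteriorPower.ιMulti k n v) =
      of φ (exteriorPower.ιMulti k n fun i => (of φ).symm (c (v i))) :=
  exteriorPower.alternatingMapLinearEquiv_apply_ιMulti _ _

end ScalarTwist

end FrobeniusTwist

section DegreeOne

theorem KaehlerDifferential.D_pow_char (k : Type*) [CommRing k] (p : ℕ) [CharP k p] (a : k) :
    D ℤ k (a ^ p) = 0 := by
  rw [Derivation.leibniz_pow, ← Nat.cast_smul_eq_nsmul k, CharP.cast_eq_zero, zero_smul]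

theorem KaehlerDifferential.pow_char_smul_D (k : Type*) [CommRing k] (p : ℕ) [CharP k p]
    (a b : k) : a ^ p • D ℤ k b = D ℤ k (a ^ p * b) := by
  rw [Derivation.leibniz, D_pow_char, smul_zero, add_zero]

open ScalarTwist in
/-- In characteristic `p`, there is a Frobenius-semilinear endomorphism of the module of
differentials of a field sending each `dy` to `y^(p-1) dy` up to exact differentials. -/
theorem KaehlerDifferential.exists_cartier_lift (k : Type*) [Field k] (p : ℕ) [hp : Fact p.Prime]
    [CharP k p] :
    ∃ c : Ω[k⁄ℤ] →ₗ[k] ScalarTwist (frobenius k p) Ω[k⁄ℤ],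
      ∀ y, ∃ b, (of _).symm (c (D ℤ k y)) = y ^ (p - 1) • D ℤ k y + D ℤ k b := by
  let φ := frobenius k p
  let B : Submodule k (ScalarTwist φ Ω[k⁄ℤ]) :=
    { carrier := Set.range fun b => of φ (D ℤ k b)
      add_mem' := by
        rintro _ _ ⟨a, rfl⟩ ⟨b, rfl⟩
        exact ⟨a + b, by simp⟩
      zero_mem' := ⟨0, by simp⟩
      smul_mem' := by
        rintro a _ ⟨b, rfl⟩
        exact ⟨a ^ p * b, by
          simp only [smul_of, φ, frobenius_def, pow_char_smul_D]⟩ }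
  let g : k →+ ScalarTwist φ Ω[k⁄ℤ] ⧸ B := AddMonoidHom.mk'
    (fun x => B.mkQ (of φ (x ^ (p - 1) • D ℤ k x))) (by
      intro x y
      obtain ⟨b, hb⟩ := KaehlerDifferential.exists_pow_smul_D_add hp.out x y
      have h0 : B.mkQ (of φ (D ℤ k b)) = 0 := by
        rw [Submodule.mkQ_apply, Submodule.Quotient.mk_eq_zero]
        exact ⟨b, rfl⟩
      rw [hb, map_add, map_add, map_add, map_add, h0, add_zero])
  have hpp : p - 1 + 1 = p := Nat.sub_add_cancel hp.out.one_le
  have hpow (x : k) : x ^ (p - 1) * x = x ^ p := by rw [← pow_succ, hpp]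
  let γ : Derivation ℤ k (ScalarTwist φ Ω[k⁄ℤ] ⧸ B) := Derivation.mk' g.toIntLinearMap (by
    intro x y
    change B.mkQ (of φ ((x * y) ^ (p - 1) • D ℤ k (x * y))) =
      x • B.mkQ (of φ (y ^ (p - 1) • D ℤ k y)) + y • B.mkQ (of φ (x ^ (p - 1) • D ℤ k x))
    rw [← map_smul B.mkQ, ← map_smul B.mkQ, ← map_add, smul_of, smul_of, ← map_add]
    congr 2
    simp only [Derivation.leibniz, smul_add, smul_smul, φ, frobenius_def, ← hpow]
    congr 2 <;> ring)
  obtain ⟨c, hc⟩ := Module.projective_lifting_property B.mkQ γ.liftKaehlerDifferential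
    B.mkQ_surjective
  refine ⟨c, fun y => ?_⟩
  have h : B.mkQ (c (D ℤ k y)) = B.mkQ (of φ (y ^ (p - 1) • D ℤ k y)) := by
    rw [← LinearMap.comp_apply, hc, Derivation.liftKaehlerDifferential_comp_D]
    rfl
  obtain ⟨b, hb⟩ := (Submodule.Quotient.eq B).1 h
  refine ⟨b, ?_⟩
  have hb' := congrArg (of φ).symm hb
  simp only [map_sub, AddEquiv.symm_apply_apply] at hb'
  rw [hb', add_sub_cancel]

end DegreeOne

section Exact

variable {k : Type*} [Field k]

theorem lform_eq (q : ℕ) (x : k) (y : Fin q → kˣ) :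
    lform k q x y = x • exteriorPower.ιMulti k q fun i => ((y i : k)⁻¹) • D ℤ k (y i) := rfl

theorem dform_eq (q : ℕ) (x : k) (m : Fin q → k) :
    dform k q x m = x • exteriorPower.ιMulti k q fun i => D ℤ k (m i) := rfl

/-- If `c` is a constant and each `du_i` is a multiple of `dm_i`, then
`c · db ∧ u_0 dm_0 ∧ … ∧ u_{q-1} dm_{q-1}` is exact. -/
theorem ExtD.smul_ιMulti_cons_mem_range (E : ExtD k) (q : ℕ) {c : k} (hc : D ℤ k c = 0) (b : k)
    (u m : Fin q → k) (hu : ∀ i, ∃ t : k, D ℤ k (u i) = t • D ℤ k (m i)) :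
    c • exteriorPower.ιMulti k (q + 1)
      (Matrix.vecCons (D ℤ k b) fun i => u i • D ℤ k (m i)) ∈ (E.d q).range := by
  let L : Ω[k⁄ℤ] →ₗ[k] ⋀[k]^(q + 1) Ω[k⁄ℤ] :=
    { toFun a := exteriorPower.ιMulti k (q + 1) (Matrix.vecCons a fun i => D ℤ k (m i))
      map_add' x y := by
        exact (exteriorPower.ιMulti k (q + 1)).map_vecCons_add _ x y
      map_smul' a x := by
        exact (exteriorPower.ιMulti k (q + 1)).map_vecCons_smul _ a x }
  have hL (i : Fin q) : L (D ℤ k (m i)) = 0 :=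
    AlternatingMap.map_eq_zero_of_eq (exteriorPower.ιMulti k (q + 1))
      (Matrix.vecCons (D ℤ k (m i)) fun i => D ℤ k (m i)) (i := 0) (j := i.succ) (by simp)
      (Fin.succ_ne_zero i).symm
  have hprod : L (D ℤ k (∏ i, u i)) = 0 := by
    refine Finset.prod_induction u (fun z => L (D ℤ k z) = 0) ?_ (by simp) ?_
    · intro x y hx hy
      rw [Derivation.leibniz, map_add, map_smul, map_smul, hx, hy, smul_zero, smul_zero, add_zero]
    · intro i _
      obtain ⟨t, ht⟩ := hu i
      rw [ht, map_smul, hL, smul_zero]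
  refine ⟨dform k q (c * b * ∏ i, u i) m, ?_⟩
  have h1 : (fun i => D ℤ k ((Fin.cons (c * b * ∏ i, u i) m : Fin (q + 1) → k) i)) =
      Matrix.vecCons (D ℤ k (c * b * ∏ i, u i)) fun i => D ℤ k (m i) := by
    ext i; refine Fin.cases ?_ (fun j => ?_) i <;> simp
  have h2 : exteriorPower.ιMulti k (q + 1) (Matrix.vecCons (D ℤ k b) fun i => u i • D ℤ k (m i)) =
      (∏ i, u i) • L (D ℤ k b) := by
    rw [← AlternatingMap.curryLeft_apply_apply]
    exact ((exteriorPower.ιMulti k (q + 1)).curryLeft (D ℤ k b)).toMultilinearMap.map_smul_univ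
      u fun i => D ℤ k (m i)
  rw [E.d_apply, dform_eq, one_smul, h1, h2]
  change L (D ℤ k (c * b * ∏ i, u i)) = _
  simp only [Derivation.leibniz, hc, map_add, map_smul, hprod, smul_zero, add_zero, zero_add,
    smul_smul]
  rw [mul_comm]

/-- If `c` is a constant, each `du_i` is a multiple of `dm_i` and some `u_j` is `1`, then
`c · u_0 dm_0 ∧ … ∧ u_q dm_q` is exact. -/
theorem ExtD.smul_ιMulti_mem_range (E : ExtD k) (q : ℕ) {c : k} (hc : D ℤ k c = 0)
    (u m : Fin (q + 1) → k) (hu : ∀ i, ∃ t : k, D ℤ k (u i) = t • D ℤ k (m i))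
    (j : Fin (q + 1)) (hj : u j = 1) :
    c • exteriorPower.ιMulti k (q + 1) (fun i => u i • D ℤ k (m i)) ∈ (E.d q).range := by
  have zero_case (u m : Fin (q + 1) → k) (hu : ∀ i, ∃ t : k, D ℤ k (u i) = t • D ℤ k (m i))
      (h0 : u 0 = 1) :
      c • exteriorPower.ιMulti k (q + 1) (fun i => u i • D ℤ k (m i)) ∈ (E.d q).range := by
    convert! E.smul_ιMulti_cons_mem_range q hc (m 0) (fun i => u i.succ) (fun i => m i.succ)
      (fun i => hu i.succ) using 3
    ext i; refine Fin.cases ?_ (fun j => ?_) i <;> simp [h0]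
  by_cases h : j = 0
  · exact zero_case u m hu (h ▸ hj)
  · have := zero_case (u ∘ Equiv.swap j 0) (m ∘ Equiv.swap j 0) (fun i => hu _) (by simpa using hj)
    change c • exteriorPower.ιMulti k (q + 1)
      ((fun i => u i • D ℤ k (m i)) ∘ Equiv.swap j 0) ∈ _ at this
    rwa [AlternatingMap.map_swap _ _ h, smul_neg, neg_mem_iff] at this

/-- Changing logarithmic differentials by exact ones changes a logarithmic form with constant
coefficient by an exact form. -/
theorem ExtD.smul_ιMulti_add_sub_lform_mem_range (E : ExtD k) (q : ℕ) {c : k}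
    (hc : D ℤ k c = 0) (y : Fin (q + 1) → kˣ) (b : Fin (q + 1) → k) :
    c • exteriorPower.ιMulti k (q + 1)
      (fun i => ((y i : k)⁻¹) • D ℤ k (y i) + D ℤ k (b i)) - lform k (q + 1) c y ∈
        (E.d q).range := by
  have hexp := (exteriorPower.ιMulti k (q + 1) (M := Ω[k⁄ℤ])).toMultilinearMap.map_add_univ
    (fun i => ((y i : k)⁻¹) • D ℤ k (y i)) (fun i => D ℤ k (b i))
  rw [← Finset.add_sum_erase _ _ (Finset.mem_univ Finset.univ), Finset.piecewise_univ] at hexp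
  change exteriorPower.ιMulti k (q + 1)
    (fun i => ((y i : k)⁻¹) • D ℤ k (y i) + D ℤ k (b i)) = _ at hexp
  rw [hexp, lform_eq, smul_add]
  change c • exteriorPower.ιMulti k (q + 1) _ + _ - _ ∈ _
  rw [add_sub_cancel_left, Finset.smul_sum]
  refine sum_mem fun s hs => ?_
  obtain ⟨j, hj⟩ : ∃ j, j ∉ s := by
    simpa [Finset.eq_univ_iff_forall] using hs
  have := E.smul_ιMulti_mem_range q hc
    (s.piecewise (fun i => ((y i : k)⁻¹)) fun _ => 1) (s.piecewise (fun i => (y i : k)) b)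
    (fun i => by
      by_cases hi : i ∈ s
      · exact ⟨-(y i : k)⁻¹ ^ 2, by simp [hi, Derivation.leibniz_inv]⟩
      · exact ⟨0, by simp [hi]⟩) j (by simp [hj])
  convert! this using 3
  ext i
  by_cases hi : i ∈ s <;> simp [hi]

end Exact

/-- For a field `k` of characteristic `p > 0`, the inverse Cartier
operator `C⁻¹ : Ω^q_k → Ω^q_k/dΩ^{q-1}_k`, determined on forms `x·dy₁/y₁∧…∧dy_q/y_q`
by `x ↦ x^p`, is a well-defined additive map, and it is `p`-semilinear:
`C⁻¹(a • ω) = a^p • C⁻¹(ω)` for `a ∈ k` and `ω` a logarithmic-type form. -/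
theorem inverse_cartier_well_defined
    (p : ℕ) (hp : p.Prime) (k : Type*) [Field k] [CharP k p]
    (E : ExtD k) (q : ℕ) :
    ∃ C : ↥(⋀[k]^(q + 1) (Ω[k⁄ℤ])) →+ (↥(⋀[k]^(q + 1) (Ω[k⁄ℤ])) ⧸ (E.d q).range),
      (∀ (x : k) (y : Fin (q + 1) → kˣ),
        C (lform k (q + 1) x y) = QuotientAddGroup.mk (lform k (q + 1) (x ^ p) y)) ∧
      (∀ (a x : k) (y : Fin (q + 1) → kˣ),
        C (a • lform k (q + 1) x y) =
          QuotientAddGroup.mk (a ^ p • lform k (q + 1) (x ^ p) y)) := by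
  have := Fact.mk hp
  obtain ⟨c, hc⟩ := KaehlerDifferential.exists_cartier_lift k p
  have hlog (y : kˣ) : ∃ b, (ScalarTwist.of _).symm (c ((y : k)⁻¹ • D ℤ k (y : k))) =
      (y : k)⁻¹ • D ℤ k (y : k) + D ℤ k b := by
    obtain ⟨b, hb⟩ := hc y
    refine ⟨(y : k)⁻¹ ^ p * b, ?_⟩
    rw [map_smul, ScalarTwist.of_symm_smul, hb, frobenius_def, smul_add,
      KaehlerDifferential.pow_char_smul_D k p, smul_smul]
    congr 2
    have hpow : (y : k)⁻¹ ^ p = (y : k)⁻¹ ^ (p - 1) * (y : k)⁻¹ := by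
      rw [← pow_succ, Nat.sub_add_cancel hp.one_le]
    rw [hpow, mul_right_comm, ← mul_pow, inv_mul_cancel₀ y.ne_zero, one_pow, one_mul]
  let T := ScalarTwist.exteriorPowerMap (frobenius k p) (q + 1) c
  let C := (QuotientAddGroup.mk' (E.d q).range).comp
    ((ScalarTwist.of (frobenius k p)).symm.toAddMonoidHom.comp T.toAddMonoidHom)
  have hC (x : k) (y : Fin (q + 1) → kˣ) :
      C (lform k (q + 1) x y) = QuotientAddGroup.mk (lform k (q + 1) (x ^ p) y) := by
    choose b hb using fun i => hlog (y i)
    have hT : (ScalarTwist.of (frobenius k p)).symm (T (lform k (q + 1) x y)) =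
        x ^ p • exteriorPower.ιMulti k (q + 1)
          (fun i => ((y i : k)⁻¹) • D ℤ k (y i : k) + D ℤ k (b i)) := by
      rw [lform_eq, map_smul, ScalarTwist.of_symm_smul, frobenius_def,
        ScalarTwist.exteriorPowerMap_ιMulti, AddEquiv.symm_apply_apply]
      simp only [hb]
    change QuotientAddGroup.mk
      ((ScalarTwist.of (frobenius k p)).symm (T (lform k (q + 1) x y))) = _
    rw [hT, QuotientAddGroup.eq_iff_sub_mem]
    exact E.smul_ιMulti_add_sub_lform_mem_range q (KaehlerDifferential.D_pow_char k p x) y b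
  refine ⟨C, hC, fun a x y => ?_⟩
  rw [show a • lform k (q + 1) x y = lform k (q + 1) (a * x) y from smul_smul _ _ _, hC, mul_pow]
  exact congrArg _ (smul_smul _ _ _).symm
end

section
/- Let k be a perfect field of characteristic p > 0. Then for q ≥ 1, ν_q(k^sep) fits into a short exact sequence of Galois modules 0 → ν_q(k^sep) → Z_1Ω^q_{k^sep} → Ω^q_{k^sep} → 0, where the second map is C (Cartier operator restricted to closed forms) composed appropriately, i.e. the sequence 0 → ν^q → Z_1Ω^q → Ω^q → 0 with maps C and 1 − C^{-1} is exact. -/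
open ExteriorAlgebra

theorem Subfield.exists_maximal_notMem {k : Type*} [Field k] (F : Subfield k) {x : k}
    (hx : x ∉ F) : ∃ M : Subfield k, F ≤ M ∧ x ∉ M ∧ ∀ N : Subfield k, M ≤ N → x ∉ N → N = M := by
  obtain ⟨M, hFM, hM⟩ := zorn_le_nonempty₀ {N : Subfield k | x ∉ N} (fun c hc hchain y hy =>
    ⟨sSup c, fun h => by
      obtain ⟨s, hs, hxs⟩ := (Subfield.mem_sSup_of_directedOn ⟨y, hy⟩ hchain.directedOn).1 h
      exact hc hs hxs, fun z hz => le_sSup hz⟩) F hx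
  exact ⟨M, hFM, hM.prop, fun N hMN hN => le_antisymm (hM.le_of_ge hN hMN) hMN⟩

theorem Subfield.adjoin_eq_top_of_maximal {p : ℕ} (hp : p.Prime) {k : Type*} [Field k] [CharP k p]
    {M : Subfield k} (hpow : ∀ y : k, y ^ p ∈ M) {x : k} (hx : x ∉ M)
    (hM : ∀ N : Subfield k, M ≤ N → x ∉ N → N = M) :
    IntermediateField.adjoin M {x} = ⊤ := by
  have := Fact.mk hp
  have hmin (y : k) (hy : y ∉ M) :
      IsIntegral M y ∧ minpoly M y = Polynomial.X ^ p - Polynomial.C (⟨y ^ p, hpow y⟩ : M) := by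
    have hirr : Irreducible (Polynomial.X ^ p - Polynomial.C (⟨y ^ p, hpow y⟩ : M)) := by
      refine X_pow_sub_C_irreducible_of_prime hp fun b hb => hy ?_
      have : (b : k) ^ p = y ^ p := congrArg Subtype.val hb
      rw [← frobenius_inj k p (show frobenius k p b = frobenius k p y from this)]
      exact b.2
    have hmonic := Polynomial.monic_X_pow_sub_C (⟨y ^ p, hpow y⟩ : M) hp.ne_zero
    have hroot : Polynomial.aeval y
        (Polynomial.X ^ p - Polynomial.C (⟨y ^ p, hpow y⟩ : M)) = 0 := by
      simp [Subfield.algebraMap_ofSubfield]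
    exact ⟨⟨_, hmonic, hroot⟩, (minpoly.eq_of_irreducible_of_monic hirr hroot hmonic).symm⟩
  have hrank (y : k) (hy : y ∉ M) : Module.finrank M (IntermediateField.adjoin M {y}) = p := by
    rw [IntermediateField.adjoin.finrank (hmin y hy).1, (hmin y hy).2,
      Polynomial.natDegree_X_pow_sub_C]
  rw [eq_top_iff]
  intro y _
  by_cases hy : y ∈ M
  · exact (IntermediateField.adjoin M {x}).algebraMap_mem ⟨y, hy⟩
  have hxy : x ∈ IntermediateField.adjoin M {y} := by
    by_contra hxy
    have := hM (IntermediateField.adjoin M {y}).toSubfield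
      (fun z hz => (IntermediateField.adjoin M {y}).algebraMap_mem ⟨z, hz⟩) hxy
    exact hy (this ▸ IntermediateField.mem_adjoin_simple_self M y)
  have := IntermediateField.adjoin.finiteDimensional (hmin y hy).1
  rw [IntermediateField.eq_of_le_of_finrank_eq
    (IntermediateField.adjoin_simple_le_iff.2 hxy) ((hrank x hx).trans (hrank y hy).symm)]
  exact IntermediateField.mem_adjoin_simple_self M y

theorem KaehlerDifferential.D_ne_zero_of_maximal {p : ℕ} (hp : p.Prime) {k : Type*} [Field k]
    [CharP k p] {M : Subfield k} (hpow : ∀ y : k, y ^ p ∈ M) {x : k} (hx : x ∉ M)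
    (hM : ∀ N : Subfield k, M ≤ N → x ∉ N → N = M) :
    KaehlerDifferential.D M k x ≠ 0 := by
  have := Fact.mk hp
  intro h0
  have htop := Subfield.adjoin_eq_top_of_maximal hp hpow hx hM
  have hint : IsIntegral M x :=
    ⟨Polynomial.X ^ p - Polynomial.C (⟨x ^ p, hpow x⟩ : M),
      Polynomial.monic_X_pow_sub_C _ hp.ne_zero, by simp [Subfield.algebraMap_ofSubfield]⟩
  have hadj : Algebra.adjoin M {x} = ⊤ := by
    rw [← IntermediateField.adjoin_simple_toSubalgebra_of_isAlgebraic hint.isAlgebraic, htop]; rfl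
  have hD : KaehlerDifferential.D M k = 0 :=
    Derivation.ext_of_adjoin_eq_top {x} hadj (by simpa [Set.EqOn] using h0)
  have : Algebra.FiniteType M k := ⟨⟨{x}, by simpa using hadj⟩⟩
  have : Algebra.FormallyUnramified M k := by
    rw [Algebra.formallyUnramified_iff, ← Submodule.subsingleton_iff k,
      ← subsingleton_iff_bot_eq_top,
      eq_comm, ← KaehlerDifferential.span_range_derivation, hD]
    simp
  have := (Algebra.FormallyUnramified.iff_isSeparable M k).1 inferInstance
  have : IsPurelyInseparable M k := by
    have : CharP M p := (RingHom.charP_iff (algebraMap M k) (algebraMap M k).injective p).2 ‹_›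
    rw [isPurelyInseparable_iff_pow_mem M p]
    exact fun y => ⟨1, ⟨y ^ p, hpow y⟩, by simp [Subfield.algebraMap_ofSubfield]⟩
  obtain ⟨z, hz⟩ := IsPurelyInseparable.surjective_algebraMap_of_isSeparable M k x
  exact hx (hz ▸ z.2)

/-- An element outside a subfield `F` containing all `p`-th powers is an eigenvector of eigenvalue
one of some derivation which vanishes on `F`. -/
theorem Subfield.exists_derivation {p : ℕ} (hp : p.Prime) {k : Type*} [Field k] [CharP k p]
    (F : Subfield k) (hpow : ∀ y : k, y ^ p ∈ F) {x : k} (hx : x ∉ F) :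
    ∃ D : Derivation ℤ k k, (∀ y ∈ F, D y = 0) ∧ D x = x := by
  obtain ⟨M, hFM, hxM, hM⟩ := F.exists_maximal_notMem hx
  obtain ⟨φ, hφ⟩ := Module.Projective.exists_dual_eq_one k
    (KaehlerDifferential.D_ne_zero_of_maximal hp (fun y => hFM (hpow y)) hxM hM)
  refine ⟨((x • φ).compDer
    (KaehlerDifferential.D M k)).restrictScalars ℤ, fun y hy => ?_, ?_⟩
  · have : KaehlerDifferential.D M k y = 0 :=
      (KaehlerDifferential.D M k).map_algebraMap (⟨y, hFM hy⟩ : M)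
    simp [this]
  · simp [hφ]

/-- The subfield `k^p(B)` of a field `k` generated by the `p`-th powers and a set `B`; it is
already generated by them as a ring. -/
def powAdjoin {p : ℕ} (hp : p.Prime) {k : Type*} [Field k] (B : Set k) : Subfield k where
  toSubring := Subring.closure (Set.range (fun c : k => c ^ p) ∪ B)
  inv_mem' := fun x hx => by
    have h : x⁻¹ = x⁻¹ ^ p * x ^ (p - 1) := by
      rcases eq_or_ne x 0 with rfl | h0
      · simp [hp.ne_zero]
      · rw [← mul_right_inj' (pow_ne_zero p h0), ← mul_assoc, ← mul_pow, mul_inv_cancel₀ h0,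
          one_pow, one_mul, ← Nat.sub_add_cancel hp.one_le, pow_succ]
        simp [h0]
    rw [h]
    exact (Subring.closure (Set.range (fun c : k => c ^ p) ∪ B)).mul_mem
      (Subring.subset_closure (Or.inl ⟨_, rfl⟩)) (Subring.pow_mem _ hx _)

section PIndependent

variable {p : ℕ} (hp : p.Prime) {k : Type*} [Field k]

theorem mem_powAdjoin_iff {B : Set k} {x : k} :
    x ∈ powAdjoin hp B ↔ x ∈ Subring.closure (Set.range (fun c : k => c ^ p) ∪ B) := Iff.rfl

theorem pow_mem_powAdjoin (B : Set k) (c : k) : c ^ p ∈ powAdjoin hp B :=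
  Subring.subset_closure (Or.inl ⟨c, rfl⟩)

theorem subset_powAdjoin (B : Set k) : B ⊆ powAdjoin hp B :=
  fun _ h => Subring.subset_closure (Or.inr h)

theorem powAdjoin_le {B : Set k} {F : Subfield k} (hF : ∀ c : k, c ^ p ∈ F) (hB : B ⊆ F) :
    powAdjoin hp B ≤ F := fun x hx =>
  (Subring.closure_le (t := F.toSubring)).2
    (Set.union_subset (by rintro _ ⟨c, rfl⟩; exact hF c) hB) hx

/-- Every finite set is contained in `k^p(B)` for a finite `p`-independent set `B`. -/
theorem exists_finset_pIndependent [DecidableEq k] (S : Finset k) :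
    ∃ B : Finset k, (S : Set k) ⊆ powAdjoin hp (B : Set k) ∧
      ∀ b ∈ B, b ∉ powAdjoin hp (B.erase b : Set k) := by
  classical
  obtain ⟨B, hB, hmin⟩ := Finset.exists_min_image
    (S.powerset.filter fun B : Finset k => (S : Set k) ⊆ powAdjoin hp (B : Set k)) Finset.card
    ⟨S, by simpa using subset_powAdjoin hp (S : Set k)⟩
  simp only [Finset.mem_filter, Finset.mem_powerset] at hB hmin
  refine ⟨B, hB.2, fun b hb hmem => ?_⟩
  have hle : powAdjoin hp (B : Set k) ≤ powAdjoin hp (B.erase b : Set k) := by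
    refine powAdjoin_le hp (pow_mem_powAdjoin hp _) fun y hy => ?_
    rcases eq_or_ne y b with rfl | hne
    · exact hmem
    · exact subset_powAdjoin hp _ (Finset.mem_coe.2 (Finset.mem_erase.2 ⟨hne, hy⟩))
  exact absurd (hmin (B.erase b) ⟨(B.erase_subset b).trans hB.1, hB.2.trans hle⟩)
    (not_le.2 (Finset.card_erase_lt_of_mem hb))

end PIndependent

/-- The logarithmic differential `dy / y`. -/
noncomputable def dlog {k : Type*} [Field k] (y : kˣ) : Ω[k⁄ℤ] :=
  ((y : k)⁻¹ : k) • KaehlerDifferential.D ℤ k y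

/-- Every finite set is contained in `k^p(b)` for a finite family `b` of units whose logarithmic
differentials admit a dual family of functionals. -/
theorem exists_dlog_dual {p : ℕ} (hp : p.Prime) {k : Type*} [Field k] [CharP k p] [DecidableEq k]
    (S : Finset k) :
    ∃ (B : Finset k) (b : B → kˣ) (φ : B → Module.Dual k (Ω[k⁄ℤ])),
      (S : Set k) ⊆ powAdjoin hp (Set.range fun i => (b i : k)) ∧
      ∀ i j, φ i (dlog (b j)) = if i = j then 1 else 0 := by
  obtain ⟨B, hS, hB⟩ := exists_finset_pIndependent hp S
  have h0 (i : B) : (i : k) ≠ 0 := fun h => hB i i.2 (by rw [h]; exact zero_mem _)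
  choose D hD hDi using fun i : B =>
    (powAdjoin hp (B.erase i : Set k)).exists_derivation hp (pow_mem_powAdjoin hp _) (hB i i.2)
  refine ⟨B, fun i => Units.mk0 i (h0 i), fun i => (D i).liftKaehlerDifferential, ?_, ?_⟩
  · simpa using hS
  · intro i j
    simp only [dlog, Units.val_mk0, map_smul, Derivation.liftKaehlerDifferential_comp_D, smul_eq_mul]
    split_ifs with hij
    · rw [hij, hDi, inv_mul_cancel₀ (h0 j)]
    · rw [hD i j (subset_powAdjoin hp _ (Finset.mem_coe.2 (Finset.mem_erase.2
        ⟨fun h => hij (Subtype.ext h.symm), j.2⟩))), mul_zero]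

section Monomial

variable (p : ℕ) {k : Type*} [Field k] {ι : Type*} [Fintype ι] (b : ι → kˣ)

/-- The monomials `c^p ∏ b_i^{α_i}` whose exponents at the indices in `s` are divisible by `p`. -/
def pMonomial (s : Finset ι) : Set k :=
  {f | ∃ (c : k) (α : ι → ℕ), (∀ i ∈ s, p ∣ α i) ∧ f = c ^ p * ∏ i, (b i : k) ^ α i}

theorem mul_mem_pMonomial {s : Finset ι} {f g : k} (hf : f ∈ pMonomial p b s)
    (hg : g ∈ pMonomial p b s) : f * g ∈ pMonomial p b s := by
  obtain ⟨c, α, hα, rfl⟩ := hf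
  obtain ⟨e, β, hβ, rfl⟩ := hg
  refine ⟨c * e, α + β, fun i hi => dvd_add (hα i hi) (hβ i hi), ?_⟩
  simp only [Pi.add_apply, pow_add, Finset.prod_mul_distrib]
  ring

theorem mem_closure_pMonomial (hp : p.Prime) [DecidableEq ι] {x : k}
    (hx : x ∈ powAdjoin hp (Set.range fun i => (b i : k))) :
    x ∈ AddSubgroup.closure (pMonomial p b ∅) := by
  rw [mem_powAdjoin_iff, Subring.mem_closure_iff] at hx
  refine AddSubgroup.closure_mono (fun y hy => ?_) hx
  induction hy using Submonoid.closure_induction with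
  | mem y hy =>
    rcases hy with ⟨c, rfl⟩ | ⟨i, rfl⟩
    · exact ⟨c, 0, by simp, by simp⟩
    · exact ⟨1, Pi.single i 1, by simp, by
        simp [Pi.single_apply, Finset.prod_ite_eq', pow_ite]⟩
  | one => exact ⟨1, 0, by simp, by simp⟩
  | mul y z _ _ hy hz => exact mul_mem_pMonomial p b hy hz

theorem D_pow_char_mul [CharP k p] (c g : k) :
    KaehlerDifferential.D ℤ k (c ^ p * g) = c ^ p • KaehlerDifferential.D ℤ k g := by
  rw [Derivation.leibniz, Derivation.leibniz_pow, ← Nat.cast_smul_eq_nsmul k, CharP.cast_eq_zero,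
    zero_smul, smul_zero, add_zero]

theorem D_prod_pow (α : ι → ℕ) :
    KaehlerDifferential.D ℤ k (∏ i, (b i : k) ^ α i) =
      (∏ i, (b i : k) ^ α i) • ∑ i, α i • dlog (b i) := by
  classical
  induction (Finset.univ : Finset ι) using Finset.induction_on with
  | empty => simp
  | insert i s hi ih =>
    have hpow : KaehlerDifferential.D ℤ k ((b i : k) ^ α i) =
        ((b i : k) ^ α i) • α i • dlog (b i) := by
      rw [Derivation.leibniz_pow, dlog, smul_comm (M := k)]
      rcases h : α i with _ | n
      · simp
      · rw [smul_smul _ (b i : k)⁻¹, pow_succ, mul_assoc, Units.mul_inv', mul_one,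
          Nat.add_sub_cancel]
    rw [Finset.prod_insert hi, Finset.sum_insert hi, Derivation.leibniz, ih, hpow, smul_smul,
      smul_smul, add_comm, smul_add, mul_comm (∏ j ∈ s, (b j : k) ^ α j)]

theorem D_pMonomial [CharP k p] (c : k) (α : ι → ℕ) :
    KaehlerDifferential.D ℤ k (c ^ p * ∏ i, (b i : k) ^ α i) =
      (c ^ p * ∏ i, (b i : k) ^ α i) • ∑ i, α i • dlog (b i) := by
  rw [D_pow_char_mul, D_prod_pow, smul_smul]

end Monomial

section Forms

variable {k : Type*} [Field k]

theorem coe_lform (n : ℕ) (x : k) (y : Fin n → kˣ) :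
    (lform k n x y : ExteriorAlgebra k (Ω[k⁄ℤ])) = x • ιMulti k n (fun i => dlog (y i)) := rfl

theorem coe_dform (n : ℕ) (x : k) (m : Fin n → k) :
    (dform k n x m : ExteriorAlgebra k (Ω[k⁄ℤ])) =
      x • ιMulti k n (fun i => KaehlerDifferential.D ℤ k (m i)) := rfl

theorem ι_mul_ιMulti {M : Type*} [AddCommGroup M] [Module k M] {n : ℕ} (v : M) (w : Fin n → M) :
    ι k v * ιMulti k n w = ιMulti k (n + 1) (Fin.cons v w : Fin (n + 1) → M) := by
  rw [ιMulti_succ_apply]; rfl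

theorem lform_eq_dform (n : ℕ) (x : k) (y : Fin n → kˣ) :
    lform k n x y = dform k n (x * ∏ i, (y i : k)⁻¹) (fun i => y i) := by
  apply Subtype.ext
  rw [coe_lform, coe_dform, mul_smul, ← AlternatingMap.map_smul_univ]
  rfl

theorem dform_mem_closure_lform (n : ℕ) (x : k) (m : Fin n → k) :
    dform k n x m ∈ AddSubgroup.closure (Set.range fun z : k × (Fin n → kˣ) => lform k n z.1 z.2) := by
  by_cases h : ∀ i, m i ≠ 0
  · refine AddSubgroup.subset_closure ⟨(x * ∏ i, m i, fun i => Units.mk0 (m i) (h i)), ?_⟩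
    simp only [lform_eq_dform, Units.val_mk0]
    rw [mul_assoc, ← Finset.prod_mul_distrib, Finset.prod_eq_one, mul_one]
    exact fun i _ => mul_inv_cancel₀ (h i)
  · push Not at h
    obtain ⟨i, hi⟩ := h
    have : dform k n x m = 0 := by
      apply Subtype.ext
      rw [coe_dform, AlternatingMap.map_coord_zero (i := i) _ (by simp [hi]), smul_zero]; rfl
    exact this ▸ zero_mem _

theorem closure_dform_eq_top (n : ℕ) :
    AddSubgroup.closure (Set.range fun z : k × (Fin n → k) => dform k n z.1 z.2) = ⊤ := by
  rw [eq_top_iff]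
  intro ω _
  have hω : ω ∈ (⊤ : Submodule k (⋀[k]^n (Ω[k⁄ℤ]))) := trivial
  rw [← exteriorPower.ιMulti_span_of_span k n _ (KaehlerDifferential.span_range_derivation ℤ k)]
    at hω
  induction hω using Submodule.closure_induction with
  | zero => exact zero_mem _
  | add _ _ _ _ h1 h2 => exact add_mem (h1 trivial) (h2 trivial)
  | smul_mem x _ h =>
    obtain ⟨v, hv, rfl⟩ := h
    choose m hm using fun i => hv (Set.mem_range_self i)
    obtain rfl : (fun i => KaehlerDifferential.D ℤ k (m i)) = v := funext hm
    exact AddSubgroup.subset_closure ⟨(x, m), rfl⟩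

theorem closure_lform_eq_top (n : ℕ) :
    AddSubgroup.closure (Set.range fun z : k × (Fin n → kˣ) => lform k n z.1 z.2) = ⊤ := by
  rw [eq_top_iff, ← closure_dform_eq_top, AddSubgroup.closure_le]
  rintro _ ⟨z, rfl⟩
  exact dform_mem_closure_lform n z.1 z.2

/-- Every form only involves finitely many elements of the field. -/
theorem exists_finset_mem_closure_dform [DecidableEq k] (n : ℕ) (ω : ⋀[k]^n (Ω[k⁄ℤ])) :
    ∃ S : Finset k, ω ∈ AddSubgroup.closure
      {η | ∃ x ∈ S, ∃ m : Fin n → k, (∀ i, m i ∈ S) ∧ η = dform k n x m} := by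
  have hω : ω ∈ AddSubgroup.closure
      (Set.range fun z : k × (Fin n → k) => dform k n z.1 z.2) := by
    rw [closure_dform_eq_top]; trivial
  induction hω using AddSubgroup.closure_induction with
  | mem _ h =>
    obtain ⟨⟨x, m⟩, rfl⟩ := h
    exact ⟨insert x (Finset.univ.image m), AddSubgroup.subset_closure
      ⟨x, by simp, m, by simp, rfl⟩⟩
  | zero => exact ⟨∅, zero_mem _⟩
  | add _ _ _ _ h1 h2 =>
    obtain ⟨S, hS⟩ := h1
    obtain ⟨T, hT⟩ := h2
    refine ⟨S ∪ T, add_mem (AddSubgroup.closure_mono ?_ hS) (AddSubgroup.closure_mono ?_ hT)⟩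
    · rintro _ ⟨x, hx, m, hm, rfl⟩
      exact ⟨x, Finset.mem_union_left _ hx, m, fun i => Finset.mem_union_left _ (hm i), rfl⟩
    · rintro _ ⟨x, hx, m, hm, rfl⟩
      exact ⟨x, Finset.mem_union_right _ hx, m, fun i => Finset.mem_union_right _ (hm i), rfl⟩
  | neg _ _ h =>
    obtain ⟨S, hS⟩ := h
    exact ⟨S, neg_mem hS⟩

theorem ι_D_mul_prod_inv_mul {n : ℕ} (x : k) (y : Fin n → kˣ) (s : Finset (Fin n)) :
    ι k (KaehlerDifferential.D ℤ k (x * ∏ i ∈ s, (y i : k)⁻¹)) *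
        ιMulti k n (fun i => KaehlerDifferential.D ℤ k (y i)) =
      (∏ i ∈ s, (y i : k)⁻¹) • (ι k (KaehlerDifferential.D ℤ k x) *
        ιMulti k n (fun i => KaehlerDifferential.D ℤ k (y i))) := by
  induction s using Finset.induction_on with
  | empty => simp
  | insert i s hi ih =>
    have h0 : ι k (KaehlerDifferential.D ℤ k (y i : k)) *
        ιMulti k n (fun i => KaehlerDifferential.D ℤ k (y i : k)) = 0 := by
      rw [ι_mul_ιMulti]
      exact AlternatingMap.map_eq_zero_of_eq _ _ (i := 0) (j := i.succ) (by simp)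
        (Fin.succ_ne_zero i).symm
    rw [Finset.prod_insert hi, mul_left_comm, Derivation.leibniz, Derivation.leibniz_inv,
      smul_smul, map_add, map_smul, map_smul, add_mul, smul_mul_assoc, smul_mul_assoc, ih, h0,
      smul_zero, add_zero, smul_smul]

theorem coe_d_lform (E : ExtD k) (n : ℕ) (x : k) (y : Fin n → kˣ) :
    (E.d n (lform k n x y) : ExteriorAlgebra k (Ω[k⁄ℤ])) =
      ι k (KaehlerDifferential.D ℤ k x) * ιMulti k n (fun i => dlog (y i)) := by
  rw [lform_eq_dform, E.d_apply, coe_dform, one_smul]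
  have h1 : (fun i => KaehlerDifferential.D ℤ k
      ((Fin.cons (x * ∏ i, (y i : k)⁻¹) (fun i => (y i : k)) : Fin (n + 1) → k) i)) =
      Fin.cons (KaehlerDifferential.D ℤ k (x * ∏ i, (y i : k)⁻¹))
        (fun i => KaehlerDifferential.D ℤ k (y i : k)) := by
    ext i; refine Fin.cases ?_ (fun i => ?_) i <;> simp
  rw [h1, ← ι_mul_ιMulti, ι_D_mul_prod_inv_mul, ← mul_smul_comm, ← AlternatingMap.map_smul_univ]
  rfl

theorem d_lform_pow (E : ExtD k) (p : ℕ) [CharP k p] (n : ℕ) (x : k) (y : Fin n → kˣ) :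
    E.d n (lform k n (x ^ p) y) = 0 := by
  apply Subtype.ext
  rw [coe_d_lform, ← mul_one (x ^ p), D_pow_char_mul]
  simp

theorem lform_sub (n : ℕ) (x x' : k) (y : Fin n → kˣ) :
    lform k n (x - x') y = lform k n x y - lform k n x' y :=
  Subtype.ext (sub_smul x x' _)

/-- The submodule `⋀^{n+1}` is mapped to `⋀^n` by contraction. -/
theorem contractLeft_mem_exteriorPower {M : Type*} [AddCommGroup M] [Module k M]
    (φ : Module.Dual k M) (n : ℕ) {x : ExteriorAlgebra k M} (hx : x ∈ ⋀[k]^(n + 1) M) :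
    CliffordAlgebra.contractLeft φ x ∈ ⋀[k]^n M := by
  induction n generalizing x with
  | zero =>
    rw [zero_add, exteriorPower, pow_one] at hx
    obtain ⟨v, rfl⟩ := hx
    rw [CliffordAlgebra.contractLeft_ι, exteriorPower, pow_zero]
    exact Submodule.algebraMap_mem _
  | succ n ih =>
    rw [exteriorPower, pow_succ'] at hx
    induction hx using Submodule.mul_induction_on' with
    | mem_mul_mem a ha w hw =>
      obtain ⟨v, rfl⟩ := ha
      rw [CliffordAlgebra.contractLeft_ι_mul]
      refine sub_mem (Submodule.smul_mem _ _ hw) ?_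
      rw [exteriorPower, pow_succ']
      exact Submodule.mul_mem_mul (LinearMap.mem_range_self _ v) (ih hw)
    | add a _ c _ ha hc => rw [map_add]; exact add_mem ha hc

/-- Contraction `Ω^{n+1} → Ω^n` with a functional on `Ω^1`. -/
noncomputable def contract {M : Type*} [AddCommGroup M] [Module k M] (φ : Module.Dual k M)
    (n : ℕ) : ⋀[k]^(n + 1) M →ₗ[k] ⋀[k]^n M :=
  (CliffordAlgebra.contractLeft φ).restrict fun _ hx => contractLeft_mem_exteriorPower φ n hx

theorem coe_contract {M : Type*} [AddCommGroup M] [Module k M] (φ : Module.Dual k M)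
    (n : ℕ) (ω : ⋀[k]^(n + 1) M) :
    (contract φ n ω : ExteriorAlgebra k M) =
      CliffordAlgebra.contractLeft φ (ω : ExteriorAlgebra k M) := rfl

end Forms

section Cartier

variable {k : Type*} [Field k] {ι : Type*} (b : ι → kˣ)

/-- The group generated by the products `f · dlog b_{i₁} ∧ … ∧ dlog b_{i_n}` with `f ∈ A`, in the
exterior algebra. -/
noncomputable def logSpan (A : Set k) (n : ℕ) : AddSubgroup (ExteriorAlgebra k (Ω[k⁄ℤ])) :=
  AddSubgroup.closure
    {x | ∃ f ∈ A, ∃ I : Fin n → ι, x = f • ιMulti k n (fun l => dlog (b (I l)))}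

variable {b}

theorem smul_ιMulti_mem_logSpan {A : Set k} {n : ℕ} {f : k} (hf : f ∈ A) (I : Fin n → ι) :
    f • ιMulti k n (fun l => dlog (b (I l))) ∈ logSpan b A n :=
  AddSubgroup.subset_closure ⟨f, hf, I, rfl⟩

theorem logSpan_le {A : Set k} {n : ℕ} {G : AddSubgroup (ExteriorAlgebra k (Ω[k⁄ℤ]))}
    (h : ∀ f ∈ A, ∀ I : Fin n → ι, f • ιMulti k n (fun l => dlog (b (I l))) ∈ G) :
    logSpan b A n ≤ G := by
  rw [logSpan, AddSubgroup.closure_le]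
  rintro _ ⟨f, hf, I, rfl⟩
  exact h f hf I

/-- Every element of `logSpan` of degree `n` is represented by combinations of `lform`s. -/
theorem coe_mem_logSpan_iff {A : Set k} {n : ℕ} {ω : ⋀[k]^n (Ω[k⁄ℤ])} :
    (ω : ExteriorAlgebra k (Ω[k⁄ℤ])) ∈ logSpan b A n ↔
      ω ∈ AddSubgroup.closure {η | ∃ f ∈ A, ∃ I : Fin n → ι, η = lform k n f (b ∘ I)} := by
  have hmap : logSpan b A n = (AddSubgroup.closure
      {η | ∃ f ∈ A, ∃ I : Fin n → ι, η = lform k n f (b ∘ I)}).map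
        (⋀[k]^n (Ω[k⁄ℤ])).subtype.toAddMonoidHom := by
    rw [AddMonoidHom.map_closure, logSpan]
    congr 1
    ext x
    constructor
    · rintro ⟨f, hf, I, rfl⟩
      exact ⟨_, ⟨f, hf, I, rfl⟩, rfl⟩
    · rintro ⟨_, ⟨f, hf, I, rfl⟩, rfl⟩
      exact ⟨f, hf, I, rfl⟩
  rw [hmap]
  constructor
  · rintro ⟨η, hη, h⟩
    rwa [← Subtype.ext h]
  · intro h
    exact ⟨ω, h, rfl⟩

theorem ι_dlog_mul_mem_logSpan {A : Set k} {n : ℕ} {x : ExteriorAlgebra k (Ω[k⁄ℤ])}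
    (hx : x ∈ logSpan b A n) (j : ι) : ExteriorAlgebra.ι k (dlog (b j)) * x ∈ logSpan b A (n + 1) := by
  refine logSpan_le (G := (logSpan b A (n + 1)).comap
    (AddMonoidHom.mulLeft (ExteriorAlgebra.ι k (dlog (b j))))) (fun f hf I => ?_) hx
  have : ExteriorAlgebra.ι k (dlog (b j)) * f • ιMulti k n (fun l => dlog (b (I l))) =
      f • ιMulti k (n + 1) (fun l => dlog (b ((Fin.cons j I : Fin (n + 1) → ι) l))) := by
    rw [mul_smul_comm, ι_mul_ιMulti]
    congr 2
    ext l; refine Fin.cases ?_ (fun l => ?_) l <;> simp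
  rw [AddSubgroup.mem_comap, AddMonoidHom.coe_mulLeft, this]
  exact smul_ιMulti_mem_logSpan hf _

theorem contractLeft_mem_logSpan {A : Set k} {φ : Module.Dual k (Ω[k⁄ℤ])}
    (hφ : ∀ j, φ (dlog (b j)) = 0 ∨ φ (dlog (b j)) = 1) {n : ℕ}
    {x : ExteriorAlgebra k (Ω[k⁄ℤ])} (hx : x ∈ logSpan b A (n + 1)) :
    CliffordAlgebra.contractLeft φ x ∈ logSpan b A n := by
  induction n generalizing x with
  | zero =>
    refine logSpan_le (G := (logSpan b A 0).comap
      (CliffordAlgebra.contractLeft φ).toAddMonoidHom) (fun f hf I => ?_) hx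
    change CliffordAlgebra.contractLeft φ (f • _) ∈ logSpan b A 0
    rw [map_smul, ιMulti_succ_apply, CliffordAlgebra.contractLeft_ι_mul, ιMulti_zero_apply,
      CliffordAlgebra.contractLeft_one, mul_zero, sub_zero]
    rcases hφ (I 0) with h | h
    · rw [h, zero_smul, smul_zero]; exact zero_mem _
    · rw [h, one_smul, ← ιMulti_zero_apply]
      exact smul_ιMulti_mem_logSpan hf Fin.elim0
  | succ n ih =>
    refine logSpan_le (G := (logSpan b A (n + 1)).comap
      (CliffordAlgebra.contractLeft φ).toAddMonoidHom) (fun f hf I => ?_) hx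
    change CliffordAlgebra.contractLeft φ (f • ιMulti k (n + 1 + 1) _) ∈ logSpan b A (n + 1)
    have htail : f • ιMulti k (n + 1) (fun l => dlog (b (Matrix.vecTail I l))) ∈
        logSpan b A (n + 1) := smul_ιMulti_mem_logSpan hf _
    have hI : f • ιMulti k (n + 1 + 1) (fun l => dlog (b (I l))) =
        ExteriorAlgebra.ι k (dlog (b (I 0))) *
          f • ιMulti k (n + 1) (fun l => dlog (b (Matrix.vecTail I l))) := by
      rw [mul_smul_comm, ιMulti_succ_apply]; rfl
    rw [hI, CliffordAlgebra.contractLeft_ι_mul]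
    refine sub_mem ?_ (ι_dlog_mul_mem_logSpan (ih htail) _)
    rcases hφ (I 0) with h | h
    · rw [h, zero_smul]; exact zero_mem _
    · rwa [h, one_smul]

theorem coe_d_of_mem_logSpan (E : ExtD k) {f : k} {τ : Ω[k⁄ℤ]}
    (hf : KaehlerDifferential.D ℤ k f = f • τ) {n : ℕ} {ω : ⋀[k]^n (Ω[k⁄ℤ])}
    (hω : (ω : ExteriorAlgebra k (Ω[k⁄ℤ])) ∈ logSpan b {f} n) :
    (E.d n ω : ExteriorAlgebra k (Ω[k⁄ℤ])) = ExteriorAlgebra.ι k τ * ω := by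
  rw [coe_mem_logSpan_iff] at hω
  induction hω using AddSubgroup.closure_induction with
  | mem _ h =>
    obtain ⟨_, rfl, I, rfl⟩ := h
    rw [coe_d_lform, hf, coe_lform, map_smul, smul_mul_assoc, mul_smul_comm]
  | zero => simp
  | add _ _ _ _ h1 h2 =>
    rw [map_add, Submodule.coe_add, Submodule.coe_add, h1, h2, mul_add]
  | neg _ _ h => rw [map_neg, NegMemClass.coe_neg, NegMemClass.coe_neg, h, mul_neg]

/-- Cartan's operator `d ∘ i_φ + i_φ ∘ d`. -/
noncomputable def lieD (E : ExtD k) (φ : Module.Dual k (Ω[k⁄ℤ])) (q : ℕ) :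
    ⋀[k]^(q + 1) (Ω[k⁄ℤ]) →+ ⋀[k]^(q + 1) (Ω[k⁄ℤ]) :=
  (E.d q).comp (contract φ q).toAddMonoidHom +
    (contract φ (q + 1)).toAddMonoidHom.comp (E.d (q + 1))

theorem lieD_apply (E : ExtD k) (φ : Module.Dual k (Ω[k⁄ℤ])) (q : ℕ)
    (ω : ⋀[k]^(q + 1) (Ω[k⁄ℤ])) :
    lieD E φ q ω = E.d q (contract φ q ω) + contract φ (q + 1) (E.d (q + 1) ω) := rfl

theorem lieD_lform (E : ExtD k) {φ : Module.Dual k (Ω[k⁄ℤ])}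
    (hφ : ∀ j, φ (dlog (b j)) = 0 ∨ φ (dlog (b j)) = 1) {f : k} {τ : Ω[k⁄ℤ]}
    (hf : KaehlerDifferential.D ℤ k f = f • τ) (q : ℕ) (I : Fin (q + 1) → ι) :
    lieD E φ q (lform k (q + 1) f (b ∘ I)) = φ τ • lform k (q + 1) f (b ∘ I) := by
  have hmem : (lform k (q + 1) f (b ∘ I) : ExteriorAlgebra k (Ω[k⁄ℤ])) ∈ logSpan b {f} (q + 1) :=
    AddSubgroup.subset_closure ⟨f, Set.mem_singleton f, I, rfl⟩
  have hmem' : (contract φ q (lform k (q + 1) f (b ∘ I)) : ExteriorAlgebra k (Ω[k⁄ℤ])) ∈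
      logSpan b {f} q := by
    rw [coe_contract]
    exact contractLeft_mem_logSpan hφ hmem
  have h1 := coe_d_of_mem_logSpan E hf hmem'
  have h2 := coe_d_of_mem_logSpan E hf hmem
  apply Subtype.ext
  rw [lieD_apply, Submodule.coe_add, coe_contract φ (q + 1), h1, h2,
    CliffordAlgebra.contractLeft_ι_mul, coe_contract, add_sub_cancel, Submodule.coe_smul]

theorem lieD_pow_mem_range (E : ExtD k) (φ : Module.Dual k (Ω[k⁄ℤ])) (q : ℕ)
    {ω : ⋀[k]^(q + 1) (Ω[k⁄ℤ])} (hω : E.d (q + 1) ω = 0) (n : ℕ) :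
    (lieD E φ q)^[n + 1] ω ∈ (E.d q).range := by
  have h (η : ⋀[k]^(q + 1) (Ω[k⁄ℤ])) (hη : E.d (q + 1) η = 0) :
      lieD E φ q η ∈ (E.d q).range := by
    rw [lieD_apply, hη, map_zero, add_zero]
    exact ⟨_, rfl⟩
  induction n with
  | zero => exact h ω hω
  | succ n ih =>
    rw [Function.iterate_succ_apply']
    refine h _ ?_
    obtain ⟨η, hη⟩ := ih
    rw [← hη, E.d_d]

theorem natCast_pow_char_sub_one {p : ℕ} (hp : p.Prime) [CharP k p] {a : ℕ} (ha : ¬ p ∣ a) :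
    (a : k) ^ (p - 1) = 1 := by
  have := Fact.mk hp
  have h : (a : ZMod p) ^ (p - 1) = 1 :=
    ZMod.pow_card_sub_one_eq_one fun h => ha ((ZMod.natCast_eq_zero_iff a p).1 h)
  simpa using congrArg (ZMod.castHom dvd_rfl k) h

variable [Fintype ι]

theorem exists_sub_mem_range_of_insert [DecidableEq ι] {p : ℕ} (hp : p.Prime) [CharP k p] (E : ExtD k)
    {φ : ι → Module.Dual k (Ω[k⁄ℤ])} (hφ : ∀ i j, φ i (dlog (b j)) = if i = j then 1 else 0)
    {q : ℕ} {s : Finset ι} (i : ι) {ω : ⋀[k]^(q + 1) (Ω[k⁄ℤ])} (hω : E.d (q + 1) ω = 0)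
    (hs : (ω : ExteriorAlgebra k (Ω[k⁄ℤ])) ∈ logSpan b (pMonomial p b s) (q + 1)) :
    ∃ η : ⋀[k]^(q + 1) (Ω[k⁄ℤ]), ω - η ∈ (E.d q).range ∧
      (η : ExteriorAlgebra k (Ω[k⁄ℤ])) ∈ logSpan b (pMonomial p b (insert i s)) (q + 1) := by
  set L := lieD E (φ i) q with hL
  have hp1 : p - 1 = p - 2 + 1 := by have := hp.two_le; omega
  refine ⟨ω - L^[p - 1] ω, ?_, ?_⟩
  · rw [sub_sub_cancel, hp1]
    exact lieD_pow_mem_range E _ q hω _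
  rw [coe_mem_logSpan_iff] at hs ⊢
  clear hω
  induction hs using AddSubgroup.closure_induction with
  | mem _ h =>
    obtain ⟨_, ⟨c, α, hα, rfl⟩, I, rfl⟩ := h
    set f := c ^ p * ∏ j, (b j : k) ^ α j with hf
    set T := lform k (q + 1) f (b ∘ I) with hT
    have hLT : L T = (α i : k) • T := by
      rw [hL, hT, lieD_lform E (fun j => by rw [hφ]; split_ifs <;> simp) (D_pMonomial p b c α)]
      congr 1
      simp [hφ]
    have hpow (n : ℕ) : L^[n] T = (α i : k) ^ n • T := by
      induction n with
      | zero => simp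
      | succ n ih =>
        rw [Function.iterate_succ_apply, hLT, Nat.cast_smul_eq_nsmul, iterate_map_nsmul, ih,
          ← Nat.cast_smul_eq_nsmul k, smul_smul, pow_succ']
    rw [hpow]
    by_cases hi : p ∣ α i
    · rw [(CharP.cast_eq_zero_iff k p _).2 hi, hp1, pow_succ, mul_zero, zero_smul, sub_zero]
      exact AddSubgroup.subset_closure ⟨f, ⟨c, α, by simpa using ⟨hi, hα⟩, rfl⟩, I, rfl⟩
    · rw [natCast_pow_char_sub_one hp hi, one_smul, sub_self]
      exact zero_mem _
  | zero => rw [iterate_map_zero, sub_zero]; exact zero_mem _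
  | add x y _ _ h1 h2 => rw [iterate_map_add, add_sub_add_comm]; exact add_mem h1 h2
  | neg x _ h => rw [iterate_map_neg, ← neg_sub', neg_mem_iff]; exact h

theorem exists_sub_mem_range [DecidableEq ι] {p : ℕ} (hp : p.Prime) [CharP k p] (E : ExtD k)
    {φ : ι → Module.Dual k (Ω[k⁄ℤ])} (hφ : ∀ i j, φ i (dlog (b j)) = if i = j then 1 else 0)
    {q : ℕ} (s : Finset ι) {ω : ⋀[k]^(q + 1) (Ω[k⁄ℤ])} (hω : E.d (q + 1) ω = 0)
    (h0 : (ω : ExteriorAlgebra k (Ω[k⁄ℤ])) ∈ logSpan b (pMonomial p b ∅) (q + 1)) :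
    ∃ η : ⋀[k]^(q + 1) (Ω[k⁄ℤ]), ω - η ∈ (E.d q).range ∧
      (η : ExteriorAlgebra k (Ω[k⁄ℤ])) ∈ logSpan b (pMonomial p b s) (q + 1) := by
  induction s using Finset.induction_on with
  | empty => exact ⟨ω, by rw [sub_self]; exact zero_mem _, h0⟩
  | insert i s _ ih =>
    obtain ⟨η, hη, hηs⟩ := ih
    have hηd : E.d (q + 1) η = 0 := by
      obtain ⟨θ, hθ⟩ := hη
      rw [← sub_sub_cancel ω η, ← hθ, map_sub, hω, E.d_d, sub_zero]
    obtain ⟨ξ, hξ, hξs⟩ := exists_sub_mem_range_of_insert hp E hφ i hηd hηs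
    exact ⟨ξ, by rw [← sub_add_sub_cancel ω η ξ]; exact add_mem hη hξ, hξs⟩

theorem ι_D_mul_mem_logSpan {p : ℕ} [CharP k p] {n : ℕ} {y : k}
    (hy : y ∈ AddSubgroup.closure (pMonomial p b ∅)) {w : ExteriorAlgebra k (Ω[k⁄ℤ])}
    (hw : w ∈ logSpan b (pMonomial p b ∅) n) :
    ExteriorAlgebra.ι k (KaehlerDifferential.D ℤ k y) * w ∈
      logSpan b (pMonomial p b ∅) (n + 1) := by
  induction hy using AddSubgroup.closure_induction with
  | mem g hg =>
    refine logSpan_le (G := (logSpan b (pMonomial p b ∅) (n + 1)).comap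
      (AddMonoidHom.mulLeft (ExteriorAlgebra.ι k (KaehlerDifferential.D ℤ k g))))
      (fun f hf I => ?_) hw
    obtain ⟨c, α, -, hgα⟩ := id hg
    rw [AddSubgroup.mem_comap, AddMonoidHom.coe_mulLeft, hgα, D_pMonomial, ← hgα, map_smul,
      smul_mul_assoc, ← mul_smul_comm, smul_smul, map_sum, Finset.sum_mul]
    refine sum_mem fun j _ => ?_
    rw [map_nsmul, smul_mul_assoc]
    exact nsmul_mem (ι_dlog_mul_mem_logSpan
      (smul_ιMulti_mem_logSpan (mul_mem_pMonomial p b hg hf) I) j) _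
  | zero => rw [map_zero, map_zero, zero_mul]; exact zero_mem _
  | add _ _ _ _ h1 h2 => rw [map_add, map_add, add_mul]; exact add_mem h1 h2
  | neg _ _ h => rw [map_neg, map_neg, neg_mul]; exact neg_mem h

theorem smul_ιMulti_D_mem_logSpan [DecidableEq ι] {p : ℕ} (hp : p.Prime) [CharP k p] {n : ℕ} {x : k}
    (hx : x ∈ powAdjoin hp (Set.range fun i => (b i : k))) {m : Fin n → k}
    (hm : ∀ l, m l ∈ powAdjoin hp (Set.range fun i => (b i : k))) :
    x • ιMulti k n (fun l => KaehlerDifferential.D ℤ k (m l)) ∈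
      logSpan b (pMonomial p b ∅) n := by
  induction n with
  | zero =>
    rw [ιMulti_zero_apply]
    refine (AddSubgroup.closure_le (K := (logSpan b (pMonomial p b ∅) 0).comap
      (LinearMap.toSpanSingleton k _ (1 : ExteriorAlgebra k (Ω[k⁄ℤ]))).toAddMonoidHom)).2 (fun f hf => ?_)
      (mem_closure_pMonomial p b hp hx)
    change f • (1 : ExteriorAlgebra k (Ω[k⁄ℤ])) ∈ logSpan b (pMonomial p b ∅) 0
    rw [← ιMulti_zero_apply]
    exact smul_ιMulti_mem_logSpan hf Fin.elim0
  | succ n ih =>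
    rw [ιMulti_succ_apply, ← mul_smul_comm]
    exact ι_D_mul_mem_logSpan (mem_closure_pMonomial p b hp (hm 0)) (ih fun l => hm l.succ)

theorem exists_lform_pow_sub_mem_range {p : ℕ} (hp : p.Prime) {k : Type*} [Field k] [CharP k p]
    (E : ExtD k) {q : ℕ} {ω : ⋀[k]^(q + 1) (Ω[k⁄ℤ])} (hω : E.d (q + 1) ω = 0) :
    ∃ η ∈ AddSubgroup.closure
        (Set.range fun z : k × (Fin (q + 1) → kˣ) => lform k (q + 1) (z.1 ^ p) z.2),
      ω - η ∈ (E.d q).range := by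
  classical
  obtain ⟨S, hS⟩ := exists_finset_mem_closure_dform (q + 1) ω
  obtain ⟨B, b, φ, hSB, hφ⟩ := exists_dlog_dual hp S
  have h0 : (ω : ExteriorAlgebra k (Ω[k⁄ℤ])) ∈ logSpan b (pMonomial p b ∅) (q + 1) := by
    refine (AddSubgroup.closure_le (K := (logSpan b (pMonomial p b ∅) (q + 1)).comap
      (⋀[k]^(q + 1) (Ω[k⁄ℤ])).subtype.toAddMonoidHom)).2 ?_ hS
    rintro _ ⟨x, hx, m, hm, rfl⟩
    exact smul_ιMulti_D_mem_logSpan hp (hSB hx) fun l => hSB (hm l)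
  obtain ⟨η, hη, hηs⟩ := exists_sub_mem_range hp E hφ Finset.univ hω h0
  refine ⟨η, AddSubgroup.closure_mono ?_ (coe_mem_logSpan_iff.1 hηs), hη⟩
  rintro _ ⟨_, ⟨c, α, hα, rfl⟩, I, rfl⟩
  choose β hβ using fun i => hα i (Finset.mem_univ i)
  refine ⟨(c * ∏ i, (b i : k) ^ β i, b ∘ I), ?_⟩
  simp only [mul_pow, ← Finset.prod_pow, ← pow_mul, hβ, mul_comm p]

end Cartier

/-- Over a separably closed field of characteristic `p` (the separable
closure `k^sep` of a perfect field `k`), with `Z₁Ω^q = ker d` the closed forms, the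
Cartier operator `C : Z₁Ω^q → Ω^q` (sending `x^p·dy₁/y₁∧…∧dy_q/y_q` to
`x·dy₁/y₁∧…∧dy_q/y_q` and killing exact forms) yields a short exact sequence
`0 → ν^q → Z₁Ω^q → Ω^q → 0`, where the second map is `1 - C` and
`ν^q = ker(1 - C⁻¹ : Ω^q → Ω^q/dΩ^{q-1})`: that is, `ω ↦ ω - C ω` is surjective and
its kernel consists exactly of the forms fixed by the (inverse) Cartier operator. -/
theorem cartier_exact_sequence_sep_closed
    (p : ℕ) (hp : p.Prime) (k : Type*) [Field k] [CharP k p] [IsSepClosed k]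
    (E : ExtD k) (q : ℕ)
    (C : ↥((E.d (q + 1)).ker) →+ ↥(⋀[k]^(q + 1) (Ω[k⁄ℤ])))
    (hC : ∀ (ω : ↥((E.d (q + 1)).ker)) (x : k) (y : Fin (q + 1) → kˣ),
      (ω : ↥(⋀[k]^(q + 1) (Ω[k⁄ℤ]))) = lform k (q + 1) (x ^ p) y →
        C ω = lform k (q + 1) x y)
    (hCd : ∀ ω : ↥((E.d (q + 1)).ker),
      (ω : ↥(⋀[k]^(q + 1) (Ω[k⁄ℤ]))) ∈ (E.d q).range → C ω = 0)
    (Cinv : ↥(⋀[k]^(q + 1) (Ω[k⁄ℤ])) →+ (↥(⋀[k]^(q + 1) (Ω[k⁄ℤ])) ⧸ (E.d q).range))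
    (hCinv : ∀ (x : k) (y : Fin (q + 1) → kˣ),
      Cinv (lform k (q + 1) x y) = QuotientAddGroup.mk (lform k (q + 1) (x ^ p) y)) :
    Function.Surjective
      (fun ω : ↥((E.d (q + 1)).ker) =>
        (ω : ↥(⋀[k]^(q + 1) (Ω[k⁄ℤ]))) - C ω) ∧
    ∀ ω : ↥((E.d (q + 1)).ker),
      ((ω : ↥(⋀[k]^(q + 1) (Ω[k⁄ℤ]))) - C ω = 0 ↔
        Cinv (ω : ↥(⋀[k]^(q + 1) (Ω[k⁄ℤ]))) =
          QuotientAddGroup.mk (ω : ↥(⋀[k]^(q + 1) (Ω[k⁄ℤ])))) := by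
  have hclosed (x : k) (y : Fin (q + 1) → kˣ) :
      lform k (q + 1) (x ^ p) y ∈ (E.d (q + 1)).ker := d_lform_pow E p (q + 1) x y
  have hCpow (x : k) (y : Fin (q + 1) → kˣ) :
      C ⟨_, hclosed x y⟩ = lform k (q + 1) x y := hC _ x y rfl
  have hCinvC (ω : (E.d (q + 1)).ker) : Cinv (C ω) = QuotientAddGroup.mk (ω : ⋀[k]^(q + 1) (Ω[k⁄ℤ])) := by
    obtain ⟨η, hη, hωη⟩ := exists_lform_pow_sub_mem_range hp E ω.2
    have key : ∃ hη' : η ∈ (E.d (q + 1)).ker, Cinv (C ⟨η, hη'⟩) = QuotientAddGroup.mk η := by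
      clear hωη
      induction hη using AddSubgroup.closure_induction with
      | mem _ h =>
        obtain ⟨⟨x, y⟩, rfl⟩ := h
        exact ⟨hclosed x y, by rw [hCpow, hCinv]⟩
      | zero => exact ⟨zero_mem _, (congrArg Cinv (map_zero C)).trans (map_zero Cinv)⟩
      | add _ _ _ _ h1 h2 =>
        obtain ⟨m1, e1⟩ := h1
        obtain ⟨m2, e2⟩ := h2
        exact ⟨add_mem m1 m2, (congrArg Cinv (map_add C ⟨_, m1⟩ ⟨_, m2⟩)).trans
          ((map_add Cinv _ _).trans (congrArg₂ (· + ·) e1 e2))⟩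
      | neg _ _ h =>
        obtain ⟨m, e⟩ := h
        exact ⟨neg_mem m, (congrArg Cinv (map_neg C ⟨_, m⟩)).trans
          ((map_neg Cinv _).trans (congrArg Neg.neg e))⟩
    obtain ⟨hη', e⟩ := key
    have hCη : C ω = C ⟨η, hη'⟩ := by
      rw [← sub_eq_zero, ← map_sub]
      exact hCd _ hωη
    rw [hCη, e, eq_comm, QuotientAddGroup.eq_iff_sub_mem]
    exact hωη
  have hlift (ω : ⋀[k]^(q + 1) (Ω[k⁄ℤ])) :
      ∃ η : (E.d (q + 1)).ker, C η = ω ∧ Cinv ω = QuotientAddGroup.mk (η : ⋀[k]^(q + 1) (Ω[k⁄ℤ])) := by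
    have hω : ω ∈ AddSubgroup.closure
        (Set.range fun z : k × (Fin (q + 1) → kˣ) => lform k (q + 1) z.1 z.2) := by
      rw [closure_lform_eq_top]; trivial
    suffices ∃ η, C η = ω from this.imp fun η h => ⟨h, h ▸ hCinvC η⟩
    induction hω using AddSubgroup.closure_induction with
    | mem _ h =>
      obtain ⟨⟨x, y⟩, rfl⟩ := h
      exact ⟨_, hCpow x y⟩
    | zero => exact ⟨0, map_zero C⟩
    | add _ _ _ _ h1 h2 =>
      obtain ⟨η1, rfl⟩ := h1
      obtain ⟨η2, rfl⟩ := h2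
      exact ⟨η1 + η2, map_add C _ _⟩
    | neg _ _ h =>
      obtain ⟨η, rfl⟩ := h
      exact ⟨-η, map_neg C _⟩
  refine ⟨fun ω => ?_, fun ω => ⟨fun h => ?_, fun h => ?_⟩⟩
  · have hω : ω ∈ AddSubgroup.closure
        (Set.range fun z : k × (Fin (q + 1) → kˣ) => lform k (q + 1) z.1 z.2) := by
      rw [closure_lform_eq_top]; trivial
    suffices ω ∈ ((E.d (q + 1)).ker.subtype - C).range from this
    refine (AddSubgroup.closure_le _).2 ?_ hω
    rintro _ ⟨⟨x, y⟩, rfl⟩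
    obtain ⟨t, ht⟩ := IsSepClosed.exists_root_C_mul_X_pow_add_C_mul_X_add_C' p p 1 (-1) (-x)
      dvd_rfl hp.two_le (neg_ne_zero.2 one_ne_zero)
    refine ⟨⟨_, hclosed t y⟩, ?_⟩
    change lform k (q + 1) (t ^ p) y - C ⟨_, hclosed t y⟩ = lform k (q + 1) x y
    rw [hCpow, ← lform_sub]
    congr 1
    linear_combination ht
  · rw [← hCinvC, ← sub_eq_zero.1 h]
  · obtain ⟨η, hη, hηinv⟩ := hlift ω
    rw [hηinv, eq_comm, QuotientAddGroup.eq_iff_sub_mem] at h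
    have : C (ω - η) = 0 := hCd _ h
    rw [map_sub, hη] at this
    rw [← neg_sub, this, neg_zero]
end
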